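/- Define f₁(γ, s) := 1 + s·(√(2γ) − 1)²/γ and f₂(γ, s) := (1/2)·(s − s/γ − 1 + √(4s + (1 − s + s/γ)²)) for γ > 0, s > 0. Then for all γ ∈ [1/2, 2] and all s ∈ [1, 80], the derivative with respect to s of the quotient s ↦ f₁(γ, s)/f₂(γ, s) satisfies |∂/∂s ( f₁(γ, s)/f₂(γ, s) )| ≤ 10.5. -/

import Mathlib

/-- `f₁(γ,s) = R̄(λ_T, γ)/σ_ε²`: asymptotic risk at the MSV-Tr regularization. -/
noncomputable def f₁ (γ s : ℝ) : ℝ := 1 + s * (Real.sqrt (2 * γ) - 1) ^ 2 / γ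

/-- `f₂(γ,s) = R̄(λ*, γ)/σ_ε²`: optimal asymptotic risk. -/
noncomputable def f₂ (γ s : ℝ) : ℝ :=
  (1 / 2) * (s - s / γ - 1 + Real.sqrt (4 * s + (1 - s + s / γ) ^ 2))

/-- `f₂ γ s` is the positive root of `x² + (1 - s + s / γ) x = s`. -/
theorem f₂_quadratic (γ : ℝ) {s : ℝ} (hs : 0 < s) :
    f₂ γ s ^ 2 + (1 - s + s / γ) * f₂ γ s = s := by
  have hR := Real.sq_sqrt (show 0 ≤ 4 * s + (1 - s + s / γ) ^ 2 by positivity)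
  unfold f₂
  linear_combination hR / 4

theorem f₂_pos (γ : ℝ) {s : ℝ} (hs : 0 < s) : 0 < f₂ γ s := by
  have h : 1 - s + s / γ < √(4 * s + (1 - s + s / γ) ^ 2) :=
    Real.lt_sqrt_of_sq_lt (by linarith)
  unfold f₂
  linarith

theorem hasDerivAt_f₁ (γ s : ℝ) : HasDerivAt (f₁ γ) ((√(2 * γ) - 1) ^ 2 / γ) s := by
  have h := (((hasDerivAt_id s).mul_const ((√(2 * γ) - 1) ^ 2)).div_const γ).const_add 1
  exact h.congr_deriv (by rw [one_mul])

theorem hasDerivAt_f₂ (γ : ℝ) {s : ℝ} (hs : 0 < s) :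
    HasDerivAt (f₂ γ) (f₂ γ s ^ 2 * (f₂ γ s + 1) / (s * (f₂ γ s ^ 2 + s))) s := by
  have hx := f₂_pos γ hs
  have hq := f₂_quadratic γ hs
  have hrad : 0 < 4 * s + (1 - s + s / γ) ^ 2 := by positivity
  have hlin : HasDerivAt (fun t : ℝ => 1 - t + t / γ) (-1 + 1 / γ) s :=
    ((hasDerivAt_id s).const_sub 1).add ((hasDerivAt_id s).div_const γ)
  have hsqrt := (((hasDerivAt_id s).const_mul 4).add (hlin.pow 2)).sqrt hrad.ne'
  have h := (((((hasDerivAt_id s).sub ((hasDerivAt_id s).div_const γ)).sub_const 1).add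
    hsqrt).const_mul (1 / 2 : ℝ))
  refine h.congr_deriv ?_
  have hR : √(4 * s + (1 - s + s / γ) ^ 2) = 2 * f₂ γ s + (1 - s + s / γ) := by
    unfold f₂
    ring
  have hRx : √(4 * s + (1 - s + s / γ) ^ 2) * f₂ γ s = f₂ γ s ^ 2 + s := by
    rw [hR]
    linear_combination hq
  have hRpos := Real.sqrt_pos.mpr hrad
  simp only [id, Pi.add_apply, Pi.pow_apply]
  generalize √(4 * s + (1 - s + s / γ) ^ 2) = R at *
  generalize f₂ γ s = x at *
  rw [← hRx]
  simp only [div_eq_mul_inv] at *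
  generalize γ⁻¹ = g at *
  field_simp
  subst hR
  push_cast
  linear_combination (-4 : ℝ) * hq

/-- The slope of `f₁ γ` is at most `2` when `1/2 ≤ γ ≤ 2`. -/
theorem f₁_slope_le {γ : ℝ} (h₁ : 1 / 2 ≤ γ) (h₂ : γ ≤ 2) : (√(2 * γ) - 1) ^ 2 / γ ≤ 2 := by
  have hlo : 1 ≤ √(2 * γ) := Real.one_le_sqrt.mpr (by linarith)
  have hhi : √(2 * γ) ≤ 2 := Real.sqrt_le_iff.mpr ⟨by norm_num, by linarith⟩
  rw [div_le_iff₀ (by linarith)]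
  nlinarith

theorem one_third_le_f₂ {γ s : ℝ} (hγ : 1 / 2 ≤ γ) (hs : 1 ≤ s) : 1 / 3 ≤ f₂ γ s := by
  have hx := f₂_pos γ (by linarith : 0 < s)
  have hq := f₂_quadratic γ (by linarith : 0 < s)
  have hdiv : s / γ ≤ 2 * s := by
    rw [div_le_iff₀ (by linarith)]
    nlinarith
  by_contra! hlt
  nlinarith [mul_le_mul_of_nonneg_right hdiv hx.le]

/-- Second bound of Lemma 5: `|∂/∂s (f₁(γ,s)/f₂(γ,s))| ≤ 10.5` for
`γ ∈ [1/2, 2]` and `s ∈ [1, 80]`. -/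
theorem stmt9 :
    ∀ γ ∈ Set.Icc (1 / 2 : ℝ) 2, ∀ s ∈ Set.Icc (1 : ℝ) 80,
      |deriv (fun s' => f₁ γ s' / f₂ γ s') s| ≤ 10.5 := by
  rintro γ ⟨hγ₁, hγ₂⟩ s ⟨hs, -⟩
  have hs₀ : 0 < s := by linarith
  have hx := one_third_le_f₂ hγ₁ hs
  have ha := f₁_slope_le hγ₁ hγ₂
  have ha₀ : 0 ≤ (√(2 * γ) - 1) ^ 2 / γ := div_nonneg (sq_nonneg _) (by linarith)
  have hf : f₁ γ s = 1 + (√(2 * γ) - 1) ^ 2 / γ * s := by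
    unfold f₁
    ring
  rw [((hasDerivAt_f₁ γ s).fun_div (hasDerivAt_f₂ γ hs₀) (by linarith)).deriv, hf]
  generalize (√(2 * γ) - 1) ^ 2 / γ = a at *
  generalize f₂ γ s = x at *
  have hx₀ : 0 < x := by linarith
  have hsplit : (a * x - (1 + a * s) * (x ^ 2 * (x + 1) / (s * (x ^ 2 + s)))) / x ^ 2 =
      a / x - (1 / s + a) * ((x + 1) / (x ^ 2 + s)) := by
    field_simp
  have hax : a / x ≤ 6 := by
    rw [div_le_iff₀ hx₀]
    linarith
  have hinv : 1 / s ≤ 1 := (div_le_one hs₀).mpr hs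
  have hfrac : (x + 1) / (x ^ 2 + s) ≤ 2 := by
    rw [div_le_iff₀ (by positivity)]
    nlinarith [sq_nonneg (x - 1)]
  have hprod : (1 / s + a) * ((x + 1) / (x ^ 2 + s)) ≤ 3 * 2 :=
    mul_le_mul (by linarith) hfrac (by positivity) (by norm_num)
  have hax₀ : 0 ≤ a / x := by positivity
  have hprod₀ : 0 ≤ (1 / s + a) * ((x + 1) / (x ^ 2 + s)) := by positivity
  rw [hsplit, abs_le]
  constructor <;> linarith
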